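/- Let (X_t)_{t≥0} be a real-valued stochastic process with continuous paths, E[X_t] = 0 for all t, and suppose there exist constants 0 ≤ 2c1 < c2 < 1 and C > 0 such that |E[X_s X_t]| ≤ C (s^{c1} + t^{c1})/(1 + |s-t|^{c2}) for all s, t ≥ 0. Then for every ε with 0 < ε < (c2 - 2c1)/4, almost surely lim_{T→∞} T^{-(1-ε)} ∫_0^T X_t dt = 0. -/

import Mathlib

open MeasureTheory Filter

theorem aux_ae_tendsto {Ω : Type*} [MeasurableSpace Ω] (P : Measure Ω)
    (Y : ℕ → Ω → ℝ) (b : ℕ → ℝ) (hY0 : ∀ n ω, 0 ≤ Y n ω)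
    (hY : ∀ n, Integrable (Y n) P) (hb : ∀ n, ∫ ω, Y n ω ∂P ≤ b n) (hs : Summable b) :
    ∀ᵐ ω ∂P, Tendsto (fun n => Y n ω) atTop (nhds 0) := by
  have h1 : ∫⁻ ω, ∑' n, ENNReal.ofReal (Y n ω) ∂P ≠ ⊤ := by
    rw [lintegral_tsum (fun n => (hY n).1.aemeasurable.ennreal_ofReal)]
    have : ∀ n, ∫⁻ ω, ENNReal.ofReal (Y n ω) ∂P ≤ ENNReal.ofReal (b n) := fun n => by
      rw [← ofReal_integral_eq_lintegral_ofReal (hY n) (Eventually.of_forall (hY0 n))]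
      exact ENNReal.ofReal_le_ofReal (hb n)
    refine ne_top_of_le_ne_top ?_ (ENNReal.tsum_le_tsum this)
    exact hs.tsum_ofReal_ne_top
  have h2 := ae_lt_top' (AEMeasurable.tsum
    (fun n => (hY n).1.aemeasurable.ennreal_ofReal)) h1
  filter_upwards [h2] with ω hω
  have h3 := ENNReal.tendsto_atTop_zero_of_tsum_ne_top hω.ne
  have h4 := (ENNReal.tendsto_toReal ENNReal.zero_ne_top).comp h3
  simpa [Function.comp_def, ENNReal.toReal_ofReal, hY0] using h4

theorem aux_prod_int {Ω : Type*} [MeasurableSpace Ω] (P : Measure Ω)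
    [IsProbabilityMeasure P] (Z : ℝ → Ω → ℝ) (hZ : Measurable (Function.uncurry Z))
    (a b M : ℝ) (hab : a ≤ b)
    (hL2 : ∀ t ∈ Set.Ioc a b, Integrable (fun ω => (Z t ω) ^ 2) P)
    (hM : ∀ t ∈ Set.Ioc a b, ∫ ω, (Z t ω) ^ 2 ∂P ≤ M) :
    Integrable (fun ω => (∫ t in a..b, Z t ω) ^ 2) P ∧
    ∫ ω, (∫ t in a..b, Z t ω) ^ 2 ∂P
      = ∫ s in a..b, ∫ t in a..b, ∫ ω, Z s ω * Z t ω ∂P := by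
  set ν := (volume : Measure ℝ).restrict (Set.Ioc a b) with hν
  have hm : ∀ t, Measurable (Z t) := fun t => hZ.comp measurable_prodMk_left
  have hmemν : ∀ᵐ t ∂ν, t ∈ Set.Ioc a b := ae_restrict_mem measurableSet_Ioc
  have hmem : ∀ᵐ q ∂(ν.prod ν), q.1 ∈ Set.Ioc a b ∧ q.2 ∈ Set.Ioc a b := by
    have e1 := Measure.quasiMeasurePreserving_fst.ae (μa := ν.prod ν) hmemν
    have e2 := Measure.quasiMeasurePreserving_snd.ae (μa := ν.prod ν) hmemν
    filter_upwards [e1, e2] with q h1 h2 using ⟨h1, h2⟩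
  have hG : Measurable (fun x : Ω × (ℝ × ℝ) => Z x.2.1 x.1 * Z x.2.2 x.1) := by
    have h1 : Measurable (fun x : Ω × (ℝ × ℝ) => Z x.2.1 x.1) :=
      hZ.comp (f := fun x : Ω × (ℝ × ℝ) => (x.2.1, x.1)) (by fun_prop)
    have h2 : Measurable (fun x : Ω × (ℝ × ℝ) => Z x.2.2 x.1) :=
      hZ.comp (f := fun x : Ω × (ℝ × ℝ) => (x.2.2, x.1)) (by fun_prop)
    exact h1.mul h2
  have hbd : ∀ x y : ℝ, |x * y| ≤ (x ^ 2 + y ^ 2) / 2 := fun x y => by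
    rw [abs_le]; constructor <;> nlinarith [sq_nonneg (x - y), sq_nonneg (x + y)]
  have hint2 : ∀ s ∈ Set.Ioc a b, ∀ t ∈ Set.Ioc a b,
      Integrable (fun ω => Z s ω * Z t ω) P := by
    intro s hs t ht
    refine (((hL2 s hs).add (hL2 t ht)).div_const 2).mono'
      ((hm s).mul (hm t)).aestronglyMeasurable (Eventually.of_forall fun ω => ?_)
    exact hbd _ _
  have hint : Integrable (fun x : Ω × (ℝ × ℝ) => Z x.2.1 x.1 * Z x.2.2 x.1)
      (P.prod (ν.prod ν)) := by
    rw [integrable_prod_iff' hG.aestronglyMeasurable]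
    constructor
    · filter_upwards [hmem] with q hq using hint2 _ hq.1 _ hq.2
    · refine Integrable.of_bound (C := M) ?_ ?_
      · exact (hG.norm.stronglyMeasurable.integral_prod_left').aestronglyMeasurable
      · filter_upwards [hmem] with q hq
        rw [Real.norm_of_nonneg (integral_nonneg fun _ => norm_nonneg _)]
        calc _ ≤ ∫ ω, ((Z q.1 ω) ^ 2 + (Z q.2 ω) ^ 2) / 2 ∂P := by
              refine integral_mono (hint2 _ hq.1 _ hq.2).norm
                (((hL2 _ hq.1).add (hL2 _ hq.2)).div_const 2) fun ω => hbd _ _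
          _ = (∫ ω, (Z q.1 ω) ^ 2 ∂P + ∫ ω, (Z q.2 ω) ^ 2 ∂P) / 2 := by
              rw [integral_div, integral_add (hL2 _ hq.1) (hL2 _ hq.2)]
          _ ≤ M := by linarith [hM _ hq.1, hM _ hq.2]
  have hsq : ∀ ω, (∫ t in a..b, Z t ω) ^ 2 = ∫ q, Z q.1 ω * Z q.2 ω ∂(ν.prod ν) := by
    intro ω
    rw [intervalIntegral.integral_of_le hab, sq,
      integral_prod_mul (fun s => Z s ω) (fun t => Z t ω)]
  simp_rw [hsq]
  refine ⟨hint.integral_prod_left, ?_⟩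
  rw [integral_integral_swap (f := fun ω (q : ℝ × ℝ) => Z q.1 ω * Z q.2 ω) hint,
    integral_prod _ hint.integral_prod_right]
  simp_rw [intervalIntegral.integral_of_le hab]
  rfl

theorem aux_kernel (c T : ℝ) (hc0 : 0 < c) (hc : c < 1) (hT : 0 ≤ T) (s : ℝ) (hs0 : 0 ≤ s)
    (hsT : s ≤ T) : ∫ t in (0:ℝ)..T, 1 / (1 + |s - t| ^ c) ≤ 2 / (1 - c) * T ^ (1 - c) := by
  have hpos : ∀ u : ℝ, 0 < 1 + |u| ^ c := fun u => by positivity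
  have hcont : Continuous (fun u : ℝ => 1 / (1 + |u| ^ c)) := by
    refine continuous_const.div ?_ fun u => (hpos u).ne'
    exact continuous_const.add (continuous_abs.rpow_const fun _ => Or.inr hc0.le)
  have hi : ∀ a b, IntervalIntegrable (fun u : ℝ => 1 / (1 + |u| ^ c)) volume a b :=
    fun a b => hcont.intervalIntegrable a b
  have hnn : ∀ u : ℝ, 0 ≤ 1 / (1 + |u| ^ c) := fun u => by have := hpos u; positivity
  have key : ∀ r, 0 ≤ r → r ≤ T → ∫ u in (0:ℝ)..r, 1 / (1 + |u| ^ c) ≤ T ^ (1 - c) / (1 - c) := by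
    intro r hr hrT
    calc ∫ u in (0:ℝ)..r, 1 / (1 + |u| ^ c) ≤ ∫ u in (0:ℝ)..r, u ^ (-c) := by
          refine intervalIntegral.integral_mono_on_of_le_Ioo hr (hi _ _)
            (intervalIntegral.intervalIntegrable_rpow' (by linarith)) fun u hu => ?_
          rw [abs_of_pos hu.1, Real.rpow_neg hu.1.le, one_div]
          exact inv_anti₀ (Real.rpow_pos_of_pos hu.1 _) (by linarith)
      _ = r ^ (1 - c) / (1 - c) := by
          rw [integral_rpow (Or.inl (by linarith)), Real.zero_rpow (by linarith)]
          ring_nf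
      _ ≤ _ := by
          have : 0 < 1 - c := by linarith
          gcongr
  rw [intervalIntegral.integral_comp_sub_left (fun u => 1 / (1 + |u| ^ c)),
    ← intervalIntegral.integral_add_adjacent_intervals (hi _ 0) (hi 0 _)]
  have h1 : ∫ u in (s - T)..0, 1 / (1 + |u| ^ c) = ∫ u in (0:ℝ)..(T - s), 1 / (1 + |u| ^ c) := by
    have := intervalIntegral.integral_comp_neg (a := 0) (b := T - s) (fun u : ℝ => 1 / (1 + |u| ^ c))
    simp only [abs_neg, neg_sub, neg_zero] at this
    exact this.symm
  rw [h1]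
  have := key (T - s) (by linarith) (by linarith)
  have := key (s - 0) (by linarith) (by linarith)
  calc _ ≤ T ^ (1 - c) / (1 - c) + T ^ (1 - c) / (1 - c) := by linarith
    _ = _ := by ring

theorem aux_path (f : ℝ → ℝ) (hf : Continuous f) (p e : ℝ) (hp : 0 < p) (he : 0 < e)
    (h1 : Tendsto (fun n : ℕ => ((((n:ℝ) + 1) ^ p) ^ (-e) *
      ∫ t in (0:ℝ)..((n:ℝ) + 1) ^ p, f t) ^ 2) atTop (nhds 0))
    (h2 : Tendsto (fun n : ℕ => ((((n:ℝ) + 1) ^ p) ^ (-e) *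
      ∫ t in (((n:ℝ) + 1) ^ p)..(((n:ℝ) + 1 + 1) ^ p), |f t|) ^ 2) atTop (nhds 0)) :
    Tendsto (fun T : ℝ => T ^ (-e) * ∫ t in (0:ℝ)..T, f t) atTop (nhds 0) := by
  have g1 := h1.sqrt
  have g2 := h2.sqrt
  simp only [Real.sqrt_sq_eq_abs, Real.sqrt_zero] at g1 g2
  have g := g1.add g2
  rw [add_zero] at g
  have hfl : Tendsto (fun T : ℝ => ⌊T ^ (1 / p)⌋₊ - 1) atTop atTop :=
    (tendsto_sub_atTop_nat 1).comp
      (tendsto_nat_floor_atTop.comp (tendsto_rpow_atTop (by positivity)))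
  have g3 := g.comp hfl
  refine squeeze_zero_norm' ?_ g3
  filter_upwards [eventually_ge_atTop 1] with T hT
  have hT0 : 0 < T := by linarith
  have hTp : 1 ≤ T ^ (1 / p) := Real.one_le_rpow hT (by positivity)
  have hfl1 : 1 ≤ ⌊T ^ (1 / p)⌋₊ := Nat.one_le_floor_iff _ |>.2 hTp
  have hcast : ((⌊T ^ (1 / p)⌋₊ - 1 : ℕ) : ℝ) + 1 = ⌊T ^ (1 / p)⌋₊ := by
    rw [Nat.cast_sub hfl1]; simp
  simp only [Function.comp, hcast]
  set m : ℝ := (⌊T ^ (1 / p)⌋₊ : ℝ) with hm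
  have hm1 : 1 ≤ m := by rw [hm]; exact Nat.one_le_cast.2 hfl1
  have hTT : (T ^ (1 / p)) ^ p = T := by
    rw [← Real.rpow_mul hT0.le]; field_simp; simp
  have hlo : m ^ p ≤ T := by
    rw [← hTT]
    exact Real.rpow_le_rpow (by linarith) (Nat.floor_le (by linarith)) hp.le
  have hhi : T ≤ (m + 1) ^ p := by
    conv_lhs => rw [← hTT]
    exact Real.rpow_le_rpow (by linarith) (Nat.lt_floor_add_one _).le hp.le
  have hmp : 0 < m ^ p := Real.rpow_pos_of_pos (by linarith) _
  have hi : ∀ a b, IntervalIntegrable f volume a b := fun a b => hf.intervalIntegrable a b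
  have hia : ∀ a b, IntervalIntegrable (fun t => |f t|) volume a b :=
    fun a b => hf.abs.intervalIntegrable a b
  have hA : |∫ t in (0:ℝ)..T, f t| ≤ |∫ t in (0:ℝ)..m ^ p, f t| +
      |(∫ t in (m ^ p)..((m + 1) ^ p), |f t|)| := by
    rw [← intervalIntegral.integral_add_adjacent_intervals (hi 0 (m ^ p)) (hi (m ^ p) T)]
    refine (abs_add_le _ _).trans (add_le_add le_rfl ?_)
    refine (intervalIntegral.abs_integral_le_integral_abs hlo).trans (le_trans ?_ (le_abs_self _))
    exact intervalIntegral.integral_mono_interval le_rfl hlo hhi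
      (Eventually.of_forall fun _ => abs_nonneg _) (hia _ _)
  rw [Real.norm_eq_abs, abs_mul, abs_mul, abs_mul, ← mul_add,
    abs_of_pos (Real.rpow_pos_of_pos hT0 _), abs_of_pos (Real.rpow_pos_of_pos hmp _)]
  refine mul_le_mul ?_ hA (abs_nonneg _) (Real.rpow_pos_of_pos hmp _).le
  exact Real.rpow_le_rpow_of_nonpos hmp hlo (by linarith)

theorem aux_diff (p m : ℝ) (hp : 1 ≤ p) (hm : 1 ≤ m) :
    (m + 1) ^ p - m ^ p ≤ p * (2 * m) ^ (p - 1) := by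
  have h0 : 0 < m + 1 := by linarith
  have h := one_add_mul_self_le_rpow_one_add (s := -(1 / (m + 1))) (p := p)
    (by rw [neg_le_neg_iff, div_le_one h0]; linarith) hp
  have e : 1 + -(1 / (m + 1)) = m / (m + 1) := by field_simp; ring
  rw [e, Real.div_rpow (by linarith) h0.le, le_div_iff₀ (Real.rpow_pos_of_pos h0 _)] at h
  have e2 : (m + 1) ^ p = (m + 1) ^ (p - 1) * (m + 1) := by
    rw [← Real.rpow_add_one h0.ne']; ring_nf
  have e3 : (1 + p * -(1 / (m + 1))) * (m + 1) ^ p = (m + 1) ^ p - p * (m + 1) ^ (p - 1) := by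
    rw [e2]; field_simp; ring
  rw [e3] at h
  have : (m + 1) ^ (p - 1) ≤ (2 * m) ^ (p - 1) :=
    Real.rpow_le_rpow h0.le (by linarith) (by linarith)
  nlinarith

theorem aux_core {Ω : Type*} [MeasurableSpace Ω] (P : Measure Ω)
    [IsProbabilityMeasure P]
    (Z : ℝ → Ω → ℝ) (c1 c2 C ε : ℝ)
    (hc1 : 0 ≤ c1) (hc12 : 2 * c1 < c2) (hc2 : c2 < 1) (hC : 0 < C)
    (hmeas : ∀ t, Measurable (Z t))
    (hcont : ∀ ω, Continuous (fun t => Z t ω))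
    (hL2 : ∀ t, 0 ≤ t → Integrable (fun ω => (Z t ω) ^ 2) P)
    (hcov : ∀ s, 0 ≤ s → ∀ t, 0 ≤ t →
      |∫ ω, Z s ω * Z t ω ∂P| ≤ C * (s ^ c1 + t ^ c1) / (1 + |s - t| ^ c2))
    (hε : 0 < ε) (hε' : ε < (c2 - 2 * c1) / 4) :
    ∀ᵐ ω ∂P,
      Tendsto (fun T : ℝ => T ^ (-(1 - ε)) * ∫ t in (0:ℝ)..T, Z t ω) atTop (nhds 0) := by
  have hc20 : 0 < c2 := by linarith
  have hZ : Measurable (Function.uncurry Z) :=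
    measurable_uncurry_of_continuous_of_measurable hcont hmeas
  have hZa : Measurable (Function.uncurry fun t ω => |Z t ω|) := by
    have := hZ.abs
    exact this
  have hsec : ∀ b, ∀ t, 0 ≤ t → t ≤ b → ∫ ω, (Z t ω) ^ 2 ∂P ≤ 2 * C * b ^ c1 := by
    intro b t ht htb
    have h := (le_abs_self _).trans (hcov t ht t ht)
    simp only [sub_self, abs_zero, Real.zero_rpow hc20.ne', add_zero, div_one, ← sq] at h
    have := Real.rpow_le_rpow ht htb hc1
    nlinarith
  -- the second moment of the integral
  have hS : ∀ T, 0 ≤ T → Integrable (fun ω => (∫ t in (0:ℝ)..T, Z t ω) ^ 2) P ∧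
      ∫ ω, (∫ t in (0:ℝ)..T, Z t ω) ^ 2 ∂P ≤
        T * (2 * C * T ^ c1 * (2 / (1 - c2) * T ^ (1 - c2))) := by
    intro T hT
    obtain ⟨i1, i2⟩ := aux_prod_int P Z hZ 0 T (2 * C * T ^ c1) hT
      (fun t ht => hL2 t ht.1.le) (fun t ht => hsec T t ht.1.le ht.2)
    refine ⟨i1, ?_⟩
    rw [i2]
    have hin : ∀ s ∈ Set.Ioc 0 T, ‖∫ t in (0:ℝ)..T, ∫ ω, Z s ω * Z t ω ∂P‖ ≤
        2 * C * T ^ c1 * (2 / (1 - c2) * T ^ (1 - c2)) := by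
      intro s hs
      have hpos : ∀ u : ℝ, 0 < 1 + |u| ^ c2 := fun u => by positivity
      have hk : Continuous (fun t : ℝ => 2 * C * T ^ c1 * (1 / (1 + |s - t| ^ c2))) := by
        refine continuous_const.mul (continuous_const.div ?_ fun u => (hpos _).ne')
        exact continuous_const.add ((continuous_const.sub continuous_id).abs.rpow_const
          fun _ => Or.inr hc20.le)
      calc _ ≤ ∫ t in (0:ℝ)..T, 2 * C * T ^ c1 * (1 / (1 + |s - t| ^ c2)) := by
            refine intervalIntegral.norm_integral_le_of_norm_le hT
              (Eventually.of_forall fun t ht => ?_) (hk.intervalIntegrable _ _)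
            refine (hcov s hs.1.le t ht.1.le).trans ?_
            rw [mul_one_div]
            have h1 := Real.rpow_le_rpow hs.1.le hs.2 hc1
            have h2 := Real.rpow_le_rpow ht.1.le ht.2 hc1
            have := hpos (s - t)
            refine div_le_div_of_nonneg_right ?_ this.le
            nlinarith
        _ ≤ _ := by
            rw [intervalIntegral.integral_const_mul]
            have := aux_kernel c2 T hc20 hc2 hT s hs.1.le hs.2
            gcongr
    have := intervalIntegral.norm_integral_le_of_norm_le_const
      (a := 0) (b := T) (by rw [Set.uIoc_of_le hT]; exact hin)
    rw [sub_zero, abs_of_nonneg hT] at this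
    rw [mul_comm]
    exact (le_abs_self _).trans this
  have hR : ∀ a b, 0 ≤ a → a ≤ b → Integrable (fun ω => (∫ t in a..b, |Z t ω|) ^ 2) P ∧
      ∫ ω, (∫ t in a..b, |Z t ω|) ^ 2 ∂P ≤ 2 * C * b ^ c1 * (b - a) ^ 2 := by
    intro a b ha hab
    obtain ⟨i1, i2⟩ := aux_prod_int P (fun t ω => |Z t ω|) hZa a b (2 * C * b ^ c1) hab
      (fun t ht => by simpa using hL2 t (by linarith [ht.1]))
      (fun t ht => by simpa using hsec b t (by linarith [ht.1]) ht.2)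
    refine ⟨i1, ?_⟩
    rw [i2]
    have hin2 : ∀ s ∈ Set.Ioc a b, ∀ t ∈ Set.Ioc a b,
        ‖∫ ω, |Z s ω| * |Z t ω| ∂P‖ ≤ 2 * C * b ^ c1 := by
      intro s hs t ht
      have hs0 : 0 ≤ s := by linarith [hs.1]
      have ht0 : 0 ≤ t := by linarith [ht.1]
      calc _ ≤ ∫ ω, ((Z s ω) ^ 2 + (Z t ω) ^ 2) / 2 ∂P := by
            refine norm_integral_le_of_norm_le (((hL2 s hs0).add (hL2 t ht0)).div_const 2)
              (Eventually.of_forall fun ω => ?_)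
            rw [Real.norm_of_nonneg (by positivity)]
            nlinarith [sq_nonneg (|Z s ω| - |Z t ω|), sq_abs (Z s ω), sq_abs (Z t ω)]
        _ = (∫ ω, (Z s ω) ^ 2 ∂P + ∫ ω, (Z t ω) ^ 2 ∂P) / 2 := by
            rw [integral_div, integral_add (hL2 s hs0) (hL2 t ht0)]
        _ ≤ _ := by linarith [hsec b s hs0 hs.2, hsec b t ht0 ht.2]
    have hin : ∀ s ∈ Set.Ioc a b, ‖∫ t in a..b, ∫ ω, |Z s ω| * |Z t ω| ∂P‖ ≤
        2 * C * b ^ c1 * (b - a) := by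
      intro s hs
      have := intervalIntegral.norm_integral_le_of_norm_le_const
        (a := a) (b := b) (by rw [Set.uIoc_of_le hab]; exact hin2 s hs)
      rwa [abs_of_nonneg (sub_nonneg.2 hab)] at this
    have := intervalIntegral.norm_integral_le_of_norm_le_const
      (a := a) (b := b) (by rw [Set.uIoc_of_le hab]; exact hin)
    rw [abs_of_nonneg (sub_nonneg.2 hab)] at this
    calc _ ≤ _ := (le_abs_self _).trans this
      _ = _ := by ring
  set p : ℝ := 2 / c2 with hp
  have hpc : p * c2 = 2 := by rw [hp]; field_simp
  have hp2 : 2 < p := by rw [hp, lt_div_iff₀ hc20]; linarith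
  have hp0 : 0 < p := by linarith
  have hsum : ∀ K r : ℝ, r < -1 → Summable (fun n : ℕ => K * ((n:ℝ) + 1) ^ r) := by
    intro K r hr
    have := (summable_nat_add_iff 1).2 (Real.summable_nat_rpow.2 hr)
    simpa using this.mul_left K
  have hT1 := aux_ae_tendsto P
    (fun n ω => ((((n:ℝ) + 1) ^ p) ^ (-(1 - ε)) * ∫ t in (0:ℝ)..((n:ℝ) + 1) ^ p, Z t ω) ^ 2)
    (fun n => 2 * C * (2 / (1 - c2)) * ((n:ℝ) + 1) ^ (p * (c1 - c2 + 2 * ε)))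
    (fun _ _ => sq_nonneg _)
    (fun n => by
      simp_rw [mul_pow]
      exact (hS _ (by positivity)).1.const_mul _)
    (fun n => by
      simp_rw [mul_pow]
      rw [integral_const_mul]
      have hm : (0:ℝ) < (n:ℝ) + 1 := by positivity
      set m := (n:ℝ) + 1
      have hmp : 0 < m ^ p := Real.rpow_pos_of_pos hm _
      refine (mul_le_mul_of_nonneg_left (hS _ hmp.le).2 (sq_nonneg _)).trans (le_of_eq ?_)
      rw [Real.rpow_mul hm.le]
      set T := m ^ p
      have e : T ^ (c1 - c2 + 2 * ε) =
          (T ^ (-(1 - ε))) ^ 2 * (T * (T ^ c1 * T ^ (1 - c2))) := by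
        rw [← Real.rpow_natCast, ← Real.rpow_mul hmp.le, ← Real.rpow_add hmp]
        nth_rewrite 3 [← Real.rpow_one T]
        rw [← Real.rpow_add hmp, ← Real.rpow_add hmp]
        congr 1; push_cast; ring
      rw [e]; ring)
    (hsum _ _ (by nlinarith))
  have hT2 := aux_ae_tendsto P
    (fun n ω => ((((n:ℝ) + 1) ^ p) ^ (-(1 - ε)) *
      ∫ t in (((n:ℝ) + 1) ^ p)..(((n:ℝ) + 1 + 1) ^ p), |Z t ω|) ^ 2)
    (fun n => 2 * C * (2 ^ p) ^ c1 * (p * 2 ^ (p - 1)) ^ 2 *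
      ((n:ℝ) + 1) ^ (-2 + p * c1 + 2 * p * ε))
    (fun _ _ => sq_nonneg _)
    (fun n => by
      simp_rw [mul_pow]
      exact (hR _ _ (by positivity)
        (Real.rpow_le_rpow (by positivity) (by linarith) hp0.le)).1.const_mul _)
    (fun n => by
      simp_rw [mul_pow]
      rw [integral_const_mul]
      have hm1 : (1:ℝ) ≤ (n:ℝ) + 1 := by simp
      set m := (n:ℝ) + 1
      have hm : 0 < m := by linarith
      have hmp : 0 < m ^ p := Real.rpow_pos_of_pos hm _
      have hle : m ^ p ≤ (m + 1) ^ p := Real.rpow_le_rpow hm.le (by linarith) hp0.le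
      refine (mul_le_mul_of_nonneg_left (hR _ _ hmp.le hle).2 (sq_nonneg _)).trans ?_
      have hd := aux_diff p m (by linarith) hm1
      have hb : (m + 1) ^ p ≤ (2 * m) ^ p :=
        Real.rpow_le_rpow (by linarith) (by linarith) hp0.le
      have hd0 := sub_nonneg.2 hle
      calc _ ≤ ((m ^ p) ^ (-(1 - ε))) ^ 2 *
            (2 * C * ((2 * m) ^ p) ^ c1 * (p * (2 * m) ^ (p - 1)) ^ 2) := by
            gcongr
        _ = _ := by
            have e : m ^ (-2 + p * c1 + 2 * p * ε) =
                ((m ^ p) ^ (-(1 - ε))) ^ 2 * ((m ^ p) ^ c1 * (m ^ (p - 1)) ^ 2) := by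
              simp only [← Real.rpow_natCast, ← Real.rpow_mul hm.le, ← Real.rpow_add hm]
              congr 1; push_cast; ring
            rw [e, Real.mul_rpow (by norm_num) hm.le, Real.mul_rpow (by norm_num) hm.le,
              Real.mul_rpow (by positivity) hmp.le]
            ring)
    (hsum _ _ (by nlinarith))
  filter_upwards [hT1, hT2] with ω h1 h2
  exact aux_path _ (hcont ω) p (1 - ε) hp0 (by linarith) h1 h2

theorem ergodic_time_average {Ω : Type*} [MeasurableSpace Ω] (P : Measure Ω)
    [IsProbabilityMeasure P]
    (X : ℝ → Ω → ℝ) (c1 c2 C ε : ℝ)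
    (hc1 : 0 ≤ c1) (hc12 : 2 * c1 < c2) (hc2 : c2 < 1) (hC : 0 < C)
    (hmeas : ∀ t, Measurable (X t))
    (hcont : ∀ᵐ ω ∂P, ContinuousOn (fun t => X t ω) (Set.Ici 0))
    (hL2 : ∀ t, 0 ≤ t → Integrable (fun ω => (X t ω) ^ 2) P)
    (hmean : ∀ t, 0 ≤ t → ∫ ω, X t ω ∂P = 0)
    (hcov : ∀ s, 0 ≤ s → ∀ t, 0 ≤ t →
      |∫ ω, X s ω * X t ω ∂P| ≤ C * (s ^ c1 + t ^ c1) / (1 + |s - t| ^ c2))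
    (hε : 0 < ε) (hε' : ε < (c2 - 2 * c1) / 4) :
    ∀ᵐ ω ∂P,
      Tendsto (fun T : ℝ => T ^ (-(1 - ε)) * ∫ t in (0:ℝ)..T, X t ω) atTop (nhds 0) := by
  obtain ⟨A, hAm, hA, hAc⟩ := hcont.exists_measurable_mem
  classical
  let Z : ℝ → Ω → ℝ := fun t => A.indicator (X (max t 0))
  have hZX : ∀ᵐ ω ∂P, ∀ t, 0 ≤ t → Z t ω = X t ω := by
    filter_upwards [hAm] with ω hω t ht
    simp [Z, hω, ht]
  have := aux_core P Z c1 c2 C ε hc1 hc12 hc2 hC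
    (fun t => (hmeas _).indicator hA)
    (fun ω => by
      by_cases hω : ω ∈ A
      · simp only [Z, Set.indicator_of_mem hω]
        exact (hAc ω hω).comp_continuous (by fun_prop) fun t => Set.mem_Ici.2 (le_max_right _ _)
      · simp only [Z, Set.indicator_of_notMem hω]
        exact continuous_const)
    (fun t ht => (hL2 t ht).congr (by
      filter_upwards [hZX] with ω h
      rw [h t ht]))
    (fun s hs t ht => by
      rw [integral_congr_ae (g := fun ω => X s ω * X t ω)]
      · exact hcov s hs t ht
      · filter_upwards [hZX] with ω h
        rw [h t ht, h s hs])
    hε hε'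
  filter_upwards [this, hZX] with ω h1 h2
  refine h1.congr' ?_
  filter_upwards [eventually_ge_atTop 0] with T hT
  congr 1
  refine intervalIntegral.integral_congr fun t ht => ?_
  rw [Set.uIcc_of_le hT] at ht
  exact h2 t ht.1
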